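/- Let r₀, M̄, ℰ > 0. There exists a constant C = C(r₀, M̄, ℰ) > 0 such that: for every N ≥ 2, setting R := r₀/N, for every family of pairwise distinct points x_1,…,x_N ∈ ℝ³ with minimal Euclidean distance d_min, every λ > 0 satisfying M^N(λ) ≤ M̄·N·λ³, λ³ ≤ ℰ·d_min² and λ ≤ (2/3)·M̄^{−1/3}, and every W ∈ ℝ³, one has for each index i: ∑_{j≠i} | U_{x_j,R}[W](x_i) − 6πR·Φ(x_i−x_j)·W | ≤ C·R·|W|, where for a ∈ ℝ³ and x ≠ a, U_{a,R}[W](x) := 6πR·Φ(x−a)·W + (R³/4)·W/|x−a|³ − (3R³/4)·((x−a)·W)·(x−a)/|x−a|⁵ is the explicit Stokeslet solution generated by a translating sphere of radius R centered at a. -/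

import Mathlib

open scoped RealInnerProductSpace

/-- The `l∞` norm of a point of `ℝ³`. -/
noncomputable def linf (x : EuclideanSpace ℝ (Fin 3)) : ℝ := max (max |x 0| |x 1|) |x 2|

/-- The particle concentration `M^N(λ)`: the supremum over centers `c ∈ ℝ³` of the number of
particles lying in the closed `l∞`-ball of center `c` and radius `r`. -/
noncomputable def Mconc (N : ℕ) (x : Fin N → EuclideanSpace ℝ (Fin 3)) (r : ℝ) : ℕ :=
  sSup { m : ℕ | ∃ c : EuclideanSpace ℝ (Fin 3), m = Nat.card {i : Fin N | linf (x i - c) ≤ r} }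

/-- The Oseen tensor `Φ(x) = (1/(8π)) (|x|⁻¹ I₃ + |x|⁻³ x ⊗ x)`, viewed as a (continuous) linear
map `ℝ³ → ℝ³`, acting by `v ↦ (1/(8π)) (|x|⁻¹ v + |x|⁻³ ⟨x, v⟩ x)`. -/
noncomputable def oseen (x : EuclideanSpace ℝ (Fin 3)) :
    EuclideanSpace ℝ (Fin 3) →L[ℝ] EuclideanSpace ℝ (Fin 3) :=
  (1 / (8 * Real.pi)) •
    (‖x‖⁻¹ • ContinuousLinearMap.id ℝ (EuclideanSpace ℝ (Fin 3)) +
      (‖x‖ ^ 3)⁻¹ • (innerSL ℝ x).smulRight x)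

/-- The explicit Stokeslet solution `U_{a,R}[W]` generated by a sphere of radius `R` centered at
`a` translating with velocity `W`:
`U_{a,R}[W](z) = 6πR Φ(z-a) W + (R³/4) W/|z-a|³ − (3R³/4) ((z-a)·W) (z-a)/|z-a|⁵`. -/
noncomputable def stokeslet (a : EuclideanSpace ℝ (Fin 3)) (R : ℝ) (W : EuclideanSpace ℝ (Fin 3))
    (z : EuclideanSpace ℝ (Fin 3)) : EuclideanSpace ℝ (Fin 3) :=
  (6 * Real.pi * R) • oseen (z - a) W + (R ^ 3 / 4 / ‖z - a‖ ^ 3) • W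
    - (3 * R ^ 3 / 4 * ⟪z - a, W⟫ / ‖z - a‖ ^ 5) • (z - a)

theorem linf_le_norm (x : EuclideanSpace ℝ (Fin 3)) : linf x ≤ ‖x‖ := by
  have h (k : Fin 3) : |x k| ≤ ‖x‖ := by simpa using PiLp.norm_apply_le x k
  exact max_le (max_le (h 0) (h 1)) (h 2)

theorem card_linf_le_Mconc (N : ℕ) (x : Fin N → EuclideanSpace ℝ (Fin 3)) (r : ℝ)
    (c : EuclideanSpace ℝ (Fin 3)) :
    Nat.card {i : Fin N | linf (x i - c) ≤ r} ≤ Mconc N x r := by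
  refine le_csSup ⟨N, ?_⟩ ⟨c, rfl⟩
  rintro m ⟨c, rfl⟩
  simpa only [Nat.card_fin] using Finite.card_subtype_le (· ∈ {i : Fin N | linf (x i - c) ≤ r})

/-- The Stokeslet solution differs from its Oseen part by a field decaying like `|z - a|⁻³`. -/
theorem norm_stokeslet_sub_oseen_le (a W z : EuclideanSpace ℝ (Fin 3)) {R : ℝ} (hR : 0 ≤ R) :
    ‖stokeslet a R W z - (6 * Real.pi * R) • oseen (z - a) W‖
      ≤ R ^ 3 * ‖W‖ / ‖z - a‖ ^ 3 := by
  rcases eq_or_ne z a with rfl | hza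
  · simp [stokeslet]
  have hr : 0 < ‖z - a‖ := norm_pos_iff.2 (sub_ne_zero.2 hza)
  set y := z - a
  have h1 : ‖(R ^ 3 / 4 / ‖y‖ ^ 3) • W‖ = R ^ 3 / 4 / ‖y‖ ^ 3 * ‖W‖ := by
    rw [norm_smul, Real.norm_of_nonneg (by positivity)]
  have h2 : ‖(3 * R ^ 3 / 4 * ⟪y, W⟫ / ‖y‖ ^ 5) • y‖
      ≤ 3 * R ^ 3 / 4 * (‖y‖ * ‖W‖) / ‖y‖ ^ 5 * ‖y‖ := by
    rw [norm_smul, norm_div, norm_mul, Real.norm_of_nonneg (by positivity : 0 ≤ 3 * R ^ 3 / 4),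
      Real.norm_of_nonneg (by positivity : 0 ≤ ‖y‖ ^ 5)]
    gcongr
    exact norm_inner_le_norm y W
  calc ‖stokeslet a R W z - (6 * Real.pi * R) • oseen y W‖
      = ‖(R ^ 3 / 4 / ‖y‖ ^ 3) • W - (3 * R ^ 3 / 4 * ⟪y, W⟫ / ‖y‖ ^ 5) • y‖ := by
        congr 1
        simp only [stokeslet, y]
        abel
    _ ≤ R ^ 3 / 4 / ‖y‖ ^ 3 * ‖W‖ + 3 * R ^ 3 / 4 * (‖y‖ * ‖W‖) / ‖y‖ ^ 5 * ‖y‖ :=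
        (norm_sub_le _ _).trans (add_le_add h1.le h2)
    _ = R ^ 3 * ‖W‖ / ‖y‖ ^ 3 := by
        field_simp
        ring

/-- Splitting at the scale `r`, particles closer than `r` are controlled by the minimal distance `d`
and the concentration, and the others by `r` itself. -/
theorem sum_inv_dist_pow_three_le {N : ℕ} (x : Fin N → EuclideanSpace ℝ (Fin 3)) {d r : ℝ}
    (hd : 0 < d) (hdist : ∀ i j, i ≠ j → d ≤ ‖x i - x j‖) (hr : 0 < r) (i : Fin N) :
    ∑ j ∈ Finset.univ.filter (fun j => j ≠ i), (‖x i - x j‖ ^ 3)⁻¹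
      ≤ Mconc N x r * (d ^ 3)⁻¹ + N * (r ^ 3)⁻¹ := by
  classical
  calc ∑ j ∈ Finset.univ.filter (fun j => j ≠ i), (‖x i - x j‖ ^ 3)⁻¹
      ≤ ∑ j ∈ Finset.univ.filter (fun j => j ≠ i),
          ((if linf (x j - x i) ≤ r then (d ^ 3)⁻¹ else 0) + (r ^ 3)⁻¹) := by
        refine Finset.sum_le_sum fun j hj => ?_
        have hij := hdist i j (Finset.mem_filter.1 hj).2.symm
        split_ifs with h
        · have : (‖x i - x j‖ ^ 3)⁻¹ ≤ (d ^ 3)⁻¹ := by gcongr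
          have : 0 ≤ (r ^ 3)⁻¹ := by positivity
          linarith
        · have : r ≤ ‖x i - x j‖ := by
            rw [norm_sub_rev]
            exact (not_le.1 h).le.trans (linf_le_norm _)
          rw [zero_add]
          gcongr
    _ ≤ ∑ j, ((if linf (x j - x i) ≤ r then (d ^ 3)⁻¹ else 0) + (r ^ 3)⁻¹) := by
        refine Finset.sum_le_sum_of_subset_of_nonneg (Finset.filter_subset _ _) fun j _ _ => ?_
        split_ifs <;> positivity
    _ = Nat.card {j : Fin N | linf (x j - x i) ≤ r} * (d ^ 3)⁻¹ + N * (r ^ 3)⁻¹ := by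
        simp [Finset.sum_add_distrib, ← Finset.sum_filter]
    _ ≤ _ := by
        gcongr
        exact card_linf_le_Mconc N x r (x i)

theorem stmt14 (r0 Mbar Ecal : ℝ) (hr0 : 0 < r0) (hMbar : 0 < Mbar) (hEcal : 0 < Ecal) :
    ∃ C : ℝ, 0 < C ∧
      ∀ (N : ℕ), 2 ≤ N →
      ∀ x : Fin N → EuclideanSpace ℝ (Fin 3), Function.Injective x →
      ∀ dmin : ℝ, IsLeast {d : ℝ | ∃ i j : Fin N, i ≠ j ∧ d = dist (x i) (x j)} dmin →
      ∀ lam : ℝ, 0 < lam →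
      (Mconc N x lam : ℝ) ≤ Mbar * N * lam ^ 3 →
      lam ^ 3 ≤ Ecal * dmin ^ 2 →
      lam ≤ (2/3) * Mbar ^ (-(1:ℝ)/3) →
      ∀ W : EuclideanSpace ℝ (Fin 3), ∀ i : Fin N,
        ∑ j ∈ Finset.univ.filter (fun j => j ≠ i),
            ‖stokeslet (x j) (r0 / N) W (x i) - (6 * Real.pi * (r0 / N)) • oseen (x i - x j) W‖
          ≤ C * (r0 / N) * ‖W‖ := by
  refine ⟨r0 ^ 2 * (Mbar * Ecal * (1 + Mbar * Ecal) + Mbar), by positivity, ?_⟩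
  intro N hN x hx d hd lam hlam hconc hlamd _ W i
  have hN1 : (1 : ℝ) ≤ N := by exact_mod_cast (by omega : 1 ≤ N)
  have hN0 : (0 : ℝ) < N := by linarith
  have hdpos : 0 < d := by
    obtain ⟨⟨k, l, hkl, rfl⟩, -⟩ := hd
    exact dist_pos.2 (hx.ne hkl)
  have hdist (k l : Fin N) (hkl : k ≠ l) : d ≤ ‖x k - x l‖ :=
    hd.2 ⟨k, l, hkl, (dist_eq_norm _ _).symm⟩
  have hone : (1 : ℝ) ≤ Mconc N x lam := by
    have : 0 < Nat.card {j : Fin N | linf (x j - x i) ≤ lam} :=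
      have : Nonempty {j : Fin N | linf (x j - x i) ≤ lam} := ⟨i, by simp [linf, hlam.le]⟩
      Nat.card_pos
    exact_mod_cast this.trans_le (card_linf_le_Mconc N x lam (x i))
  have hlow : 1 ≤ Mbar * N * lam ^ 3 := hone.trans hconc
  have hNd : 1 ≤ (1 + Mbar * Ecal) * (N * d) := by
    have hsq : 1 ≤ Mbar * Ecal * (N * d) ^ 2 :=
      calc 1 ≤ Mbar * N * lam ^ 3 := hlow
        _ ≤ Mbar * N * (Ecal * d ^ 2) := by gcongr
        _ = Mbar * Ecal * d ^ 2 * (N * 1) := by ring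
        _ ≤ Mbar * Ecal * d ^ 2 * (N * N) := by gcongr
        _ = Mbar * Ecal * (N * d) ^ 2 := by ring
    by_contra! h
    have hME : 0 < Mbar * Ecal := by positivity
    have hp : 0 < N * d := by positivity
    nlinarith [mul_pos hME hp]
  have hsum : ∑ j ∈ Finset.univ.filter (fun j => j ≠ i), (‖x i - x j‖ ^ 3)⁻¹
      ≤ (Mbar * Ecal * (1 + Mbar * Ecal) + Mbar) * (N : ℝ) ^ 2 := by
    refine (sum_inv_dist_pow_three_le x hdpos hdist hlam i).trans ?_
    have hnear : Mconc N x lam * (d ^ 3)⁻¹ ≤ Mbar * Ecal * (1 + Mbar * Ecal) * (N : ℝ) ^ 2 := by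
      rw [← div_eq_mul_inv, div_le_iff₀ (by positivity)]
      calc (Mconc N x lam : ℝ) ≤ Mbar * N * lam ^ 3 := hconc
        _ ≤ Mbar * N * (Ecal * d ^ 2) := by gcongr
        _ = Mbar * N * (Ecal * d ^ 2) * 1 := by ring
        _ ≤ Mbar * N * (Ecal * d ^ 2) * ((1 + Mbar * Ecal) * (N * d)) := by gcongr
        _ = _ := by ring
    have hfar : N * (lam ^ 3)⁻¹ ≤ Mbar * (N : ℝ) ^ 2 := by
      rw [← div_eq_mul_inv, div_le_iff₀ (by positivity)]
      calc (N : ℝ) = N * 1 := by ring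
        _ ≤ N * (Mbar * N * lam ^ 3) := by gcongr
        _ = _ := by ring
    linarith
  calc ∑ j ∈ Finset.univ.filter (fun j => j ≠ i),
        ‖stokeslet (x j) (r0 / N) W (x i) - (6 * Real.pi * (r0 / N)) • oseen (x i - x j) W‖
      ≤ ∑ j ∈ Finset.univ.filter (fun j => j ≠ i),
          (r0 / N) ^ 3 * ‖W‖ * (‖x i - x j‖ ^ 3)⁻¹ := by
        refine Finset.sum_le_sum fun j _ => ?_
        rw [← div_eq_mul_inv]
        exact norm_stokeslet_sub_oseen_le _ _ _ (by positivity)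
    _ ≤ (r0 / N) ^ 3 * ‖W‖ *
          ((Mbar * Ecal * (1 + Mbar * Ecal) + Mbar) * (N : ℝ) ^ 2) := by
        rw [← Finset.mul_sum]
        gcongr
    _ = _ := by
        field_simp
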